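/- arXiv:2406.12748 — 2 statements merged into one kernel-verified Lean document; each statement's English description precedes it below -/
import Mathlib

section
/- For every real number x with 0 ≤ x ≤ 1, one has 2(1 − e^x) + x(1 + e^x) ≤ x³/3. -/
theorem exp_cubic_ineq (x : ℝ) (h0 : 0 ≤ x) (h1 : x ≤ 1) :
    2 * (1 - Real.exp x) + x * (1 + Real.exp x) ≤ x ^ 3 / 3 := by
  have h := Real.sum_le_exp_of_nonneg h0 4
  simp [Finset.sum_range_succ, Nat.factorial] at h
  have h2 := mul_le_mul_of_nonneg_left h (by linarith : (0 : ℝ) ≤ 2 - x)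
  have h3 : 0 ≤ x ^ 3 * (1 - x) := mul_nonneg (by positivity) (by linarith)
  nlinarith [h2, h3]
end

section
/- Let L > 0, C ≥ 0, D ≥ 0 and τ ≥ 0 be real numbers with L·τ ≤ 1. Then ((2LC + D)/(2L³))·(2(1 − e^{Lτ}) + Lτ(1 + e^{Lτ})) − (D/(2L³))·((Lτ − 1)e^{Lτ} + 1 − (Lτ)²/2) ≤ (L·C/3)·τ³. -/
theorem trotter_scalar_cubic_bound (L C D τ : ℝ) (hL : 0 < L) (hC : 0 ≤ C)
    (hD : 0 ≤ D) (hτ : 0 ≤ τ) (hLτ : L * τ ≤ 1) :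
    ((2 * L * C + D) / (2 * L ^ 3)) *
        (2 * (1 - Real.exp (L * τ)) + L * τ * (1 + Real.exp (L * τ))) -
      (D / (2 * L ^ 3)) *
        ((L * τ - 1) * Real.exp (L * τ) + 1 - (L * τ) ^ 2 / 2)
      ≤ (L * C / 3) * τ ^ 3 := by
  have hx : 0 ≤ L * τ := by positivity
  have hR : (L * C / 3) * τ ^ 3 = C / L ^ 2 * ((L * τ) ^ 3 / 3) := by
    field_simp
  rw [hR]
  generalize L * τ = x at *
  have he := Real.sum_le_exp_of_nonneg hx 4
  simp only [Finset.sum_range_succ, Finset.sum_range_zero, Nat.factorial] at he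
  norm_num at he
  generalize Real.exp x = e at *
  have h3 : 0 ≤ x ^ 3 := by positivity
  have h1 : 2 * (1 - e) + x * (1 + e) ≤ x ^ 3 / 3 := by
    have ha := mul_le_mul_of_nonneg_left he (show 0 ≤ 2 - x by linarith)
    have hb := mul_le_mul_of_nonneg_left hLτ h3
    nlinarith
  have h2 : 1 + x + x ^ 2 / 2 - e ≤ 0 := by linarith
  have hc : 0 ≤ C / L ^ 2 := by positivity
  have hd : 0 ≤ D / (2 * L ^ 3) := by positivity
  have k1 := mul_le_mul_of_nonneg_left h1 hc
  have k2 := mul_nonpos_of_nonneg_of_nonpos hd h2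
  have hs : (2 * L * C + D) / (2 * L ^ 3) = C / L ^ 2 + D / (2 * L ^ 3) := by
    field_simp
  rw [hs]
  linarith
end
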